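/- Let B_m, B_{m+2}, …, B_{m+2r+2} be holomorphic modular forms for Γ of respective weights m, m+2, …, m+2r+2, and consider the differential operator K_B f = B_m ∂_{w−r}^{r+1} f + B_{m+2} ∂_{w−r}^r f + … + B_{m+2r+2} f. If f : ℍ → ℂ is a holomorphic solution of K_B f = 0, then f(z+1) and z^{r−w} f(−1/z) are also solutions; consequently, for any γ = (a b; c d) ∈ Γ, the function (cz+d)^{r−w} f(γz) is a solution. -/

import Mathlib

open Complex UpperHalfPlane Finset
open scoped Manifold MatrixGroups Real

noncomputable section

/-- The nome `q = e^{2πiz}`. -/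
def qexp (z : ℍ) : ℂ := Complex.exp (2 * Real.pi * Complex.I * z)

/-- The normalized Eisenstein series `E_k` (for even `k ≥ 2`), defined via its
`q`-expansion `E_k = 1 - (2k/B_k) ∑_{n ≥ 1} σ_{k-1}(n) q^n`. -/
def Eis (k : ℕ) (z : ℍ) : ℂ :=
  1 - (2 * k / ((bernoulli k : ℚ) : ℂ)) *
    ∑' n : ℕ, (ArithmeticFunction.sigma (k - 1) (n + 1) : ℂ) * qexp z ^ (n + 1)

/-- The modular discriminant `Δ = (E_4³ − E_6²)/1728`. -/
def Disc (z : ℍ) : ℂ := (Eis 4 z ^ 3 - Eis 6 z ^ 2) / 1728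

/-- The space of holomorphic modular forms of weight `w` for the full modular group,
as a set of functions on `ℍ`. -/
def Mset (w : ℤ) : Set (ℍ → ℂ) :=
  {f | ∃ F : ModularForm (⊤ : Subgroup SL(2, ℤ)) w, ⇑F = f}

/-- The set of quasimodular forms of weight `w` and depth `≤ r`:
functions of the form `∑_{ℓ=0}^r E_2^ℓ h_ℓ` with `h_ℓ ∈ M_{w-2ℓ}`. -/
def QMset (w : ℤ) (r : ℕ) : Set (ℍ → ℂ) :=
  {f | ∃ h : ℕ → ℍ → ℂ, (∀ ℓ ≤ r, h ℓ ∈ Mset (w - 2 * ℓ)) ∧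
        ∀ z, f z = ∑ ℓ ∈ Finset.range (r + 1), Eis 2 z ^ ℓ * h ℓ z}

/-- `QM_w^r` as a `ℂ`-subspace of the functions on `ℍ`. -/
def QM (w : ℤ) (r : ℕ) : Submodule ℂ (ℍ → ℂ) := Submodule.span ℂ (QMset w r)

/-- `dim QM_w^r`. -/
def dimQM (w : ℤ) (r : ℕ) : ℕ := Module.finrank ℂ (QM w r)

/-- The complex derivative of a function on `ℍ` (via an extension to `ℂ`; since `ℍ` is
open in `ℂ` this agrees with the complex derivative for holomorphic `f`). -/
def hderiv (f : ℍ → ℂ) (z : ℍ) : ℂ :=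
  deriv (fun w : ℂ => if h : 0 < w.im then f ⟨w, h⟩ else 0) z

/-- The normalized derivative `f' = (2πi)⁻¹ df/dz = q df/dq`. -/
def qderiv (f : ℍ → ℂ) (z : ℍ) : ℂ := (2 * Real.pi * Complex.I)⁻¹ * hderiv f z

/-- The Serre derivative `∂_w f = f' - (w/12) E_2 f`. -/
def serre (w : ℤ) (f : ℍ → ℂ) (z : ℍ) : ℂ :=
  qderiv f z - ((w : ℂ) / 12) * Eis 2 z * f z

/-- Iterated Serre derivatives: `∂_w^0 f = f`, `∂_w^{k+1} f = ∂_{w+2k}(∂_w^k f)`. -/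
def serreIter (w : ℤ) : ℕ → (ℍ → ℂ) → (ℍ → ℂ)
  | 0, f => f
  | (k + 1), f => serre (w + 2 * k) (serreIter w k f)

/-- `z ↦ -1/z` as a map `ℍ → ℍ`. -/
def Sact (z : ℍ) : ℍ :=
  ⟨-(z : ℂ)⁻¹, by
    have h0 : (z : ℂ) ≠ 0 := z.ne_zero
    have : (-(z : ℂ)⁻¹).im = (z : ℂ).im / Complex.normSq (z : ℂ) := by
      rw [Complex.neg_im, Complex.inv_im]; ring
    rw [this]
    exact div_pos z.im_pos (Complex.normSq_pos.mpr h0)⟩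

/-- `z ↦ z + 1` as a map `ℍ → ℍ`. -/
def Tact (z : ℍ) : ℍ := ⟨(z : ℂ) + 1, by simpa using z.im_pos⟩

/-- `g` has a `q`-expansion with vanishing order exactly `ν` at `i∞`:
`g = q^ν ∑_{n≥0} a(n) qⁿ` with `a(0) ≠ 0`. -/
def HasQExpansionAt (g : ℍ → ℂ) (ν : ℕ) : Prop :=
  ∃ a : ℕ → ℂ, a 0 ≠ 0 ∧ ∀ z : ℍ, HasSum (fun n : ℕ => a n * qexp z ^ (ν + n)) (g z)

/-- The quasimodular forms `g_ℓ` attached to `f = ∑_{ℓ=0}^r E_2^ℓ h_ℓ`, defined by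
`C(r,ℓ) g_ℓ = (6/(πi))^ℓ ∑_{m=0}^{r-ℓ} C(ℓ+m,m) E_2^m h_{ℓ+m}`. -/
def gOf (r : ℕ) (h : ℕ → ℍ → ℂ) (ℓ : ℕ) (z : ℍ) : ℂ :=
  ((r.choose ℓ : ℂ))⁻¹ * (6 / ((Real.pi : ℂ) * Complex.I)) ^ ℓ *
    ∑ m ∈ Finset.range (r - ℓ + 1), (((ℓ + m).choose m : ℕ) : ℂ) * Eis 2 z ^ m * h (ℓ + m) z

/-- `f` is a balanced quasimodular form of weight `w` and depth `r`. -/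
def IsBalancedQM (w : ℤ) (r : ℕ) (f : ℍ → ℂ) : Prop :=
  ∃ h : ℕ → ℍ → ℂ, ∃ lam : ℕ → ℕ,
    (∀ ℓ ≤ r, h ℓ ∈ Mset (w - 2 * ℓ)) ∧ h r ≠ 0 ∧
    (∀ z, f z = ∑ ℓ ∈ Finset.range (r + 1), Eis 2 z ^ ℓ * h ℓ z) ∧
    (∀ ℓ ≤ r, HasQExpansionAt (gOf r h ℓ) (lam ℓ)) ∧
    (∀ i j, i ≤ j → j ≤ r → lam j ≤ lam i) ∧
    (∀ ℓ ≤ r, lam ℓ < dimQM (w - 2 * ℓ) (r - ℓ)) ∧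
    (∑ ℓ ∈ Finset.range (r + 1), lam ℓ) = dimQM w r - 1

/-- `f` is the normalized extremal quasimodular form of weight `w` and depth `r`:
`f ∈ QM_w^r` with `q`-expansion `q^{dim QM_w^r - 1}(1 + O(q))`. -/
def IsNormalizedExtremalQM (w : ℤ) (r : ℕ) (f : ℍ → ℂ) : Prop :=
  f ∈ QM w r ∧ ∃ a : ℕ → ℂ, a 0 = 1 ∧
    ∀ z : ℍ, HasSum (fun n : ℕ => a n * qexp z ^ (dimQM w r - 1 + n)) (f z)

/-- `f 0, …, f (n-1)` is a fundamental system of solutions of the linear differential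
equation `K g = 0`: holomorphic linearly independent solutions spanning all
holomorphic solutions. -/
def IsFundamentalSystem {n : ℕ} (K : (ℍ → ℂ) → (ℍ → ℂ)) (f : Fin n → ℍ → ℂ) : Prop :=
  (∀ i, MDifferentiable 𝓘(ℂ) 𝓘(ℂ) (f i)) ∧ (∀ i, K (f i) = 0) ∧
    LinearIndependent ℂ f ∧
    ∀ g : ℍ → ℂ, MDifferentiable 𝓘(ℂ) 𝓘(ℂ) g → K g = 0 → g ∈ Submodule.span ℂ (Set.range f)


/-- `F = (f_0, …, f_r)ᵀ` is a quasimodular vector of weight `w` and dimension `r+1`: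
all components are holomorphic and there is a quasimodular form `f = ∑_{ℓ=0}^s E_2^ℓ h_ℓ`
of weight `w` and depth `s ≤ r` such that
`f_k(z) = ∑_{ℓ=0}^{min(k,s)} C(k,ℓ) z^{k-ℓ} g_ℓ(z)` for the attached forms `g_ℓ`. -/
def IsQuasimodularVector (w : ℤ) (r : ℕ) (F : Fin (r + 1) → ℍ → ℂ) : Prop :=
  (∀ k, MDifferentiable 𝓘(ℂ) 𝓘(ℂ) (F k)) ∧
  ∃ s : ℕ, s ≤ r ∧ ∃ h : ℕ → ℍ → ℂ,
    (∀ ℓ ≤ s, h ℓ ∈ Mset (w - 2 * ℓ)) ∧ (s = 0 ∨ h s ≠ 0) ∧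
    ∀ (k : Fin (r + 1)) (z : ℍ),
      F k z = ∑ ℓ ∈ Finset.range (min (k : ℕ) s + 1),
        (((k : ℕ).choose ℓ : ℕ) : ℂ) * (z : ℂ) ^ ((k : ℕ) - ℓ) * gOf s h ℓ z

/-- The modular Wronskian `W(z) = det(F, ∂_{w-r}F, …, ∂_{w-r}^r F)`. -/
def modularWronskian (w : ℤ) (r : ℕ) (F : Fin (r + 1) → ℍ → ℂ) (z : ℍ) : ℂ :=
  Matrix.det (Matrix.of fun (k j : Fin (r + 1)) => serreIter (w - r) (j : ℕ) (F k) z)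

end

open scoped ModularForm

lemma Eis_two : Eis 2 = EisensteinSeries.E2 := by
  ext z
  rw [EisensteinSeries.E2_eq_tsum_cexp,
    tsum_pnat_eq_tsum_succ (f := fun n : ℕ ↦
      (ArithmeticFunction.sigma 1 n : ℂ) * Complex.exp (2 * π * Complex.I * z) ^ n)]
  have h : (2 * ((2 : ℕ) : ℂ) / ((bernoulli 2 : ℚ) : ℂ)) = 24 := by
    rw [bernoulli_two]
    norm_num
  simp only [Eis, qexp, h, Nat.reduceSub]

lemma qderiv_eq_normalizedDerivOfComplex (f : ℍ → ℂ) :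
    qderiv f = Derivative.normalizedDerivOfComplex f := by
  ext z
  rw [qderiv, hderiv, Derivative.normalizedDerivOfComplex]
  congr 1
  apply Filter.EventuallyEq.deriv_eq
  filter_upwards [isOpen_upperHalfPlaneSet.mem_nhds z.im_pos] with u hu
  have hu' : 0 < u.im := hu
  simp [hu', ofComplex_apply_of_im_pos hu']

lemma serre_eq_serreDerivative (k : ℤ) (f : ℍ → ℂ) :
    serre k f = Derivative.serreDerivative k f := by
  ext z
  rw [serre, Derivative.serreDerivative_apply, qderiv_eq_normalizedDerivOfComplex, Eis_two,
    div_eq_mul_inv]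

lemma mdifferentiable_serreIter (k : ℤ) (n : ℕ) {f : ℍ → ℂ}
    (hf : MDifferentiable 𝓘(ℂ) 𝓘(ℂ) f) : MDifferentiable 𝓘(ℂ) 𝓘(ℂ) (serreIter k n f) := by
  induction n with
  | zero => exact hf
  | succ n ih =>
    rw [serreIter, serre_eq_serreDerivative]
    exact Derivative.serreDerivative_mdifferentiable _ ih

/-- The iterated Serre derivative is equivariant under the slash action. -/
lemma serreIter_slash (k : ℤ) (n : ℕ) {f : ℍ → ℂ} (hf : MDifferentiable 𝓘(ℂ) 𝓘(ℂ) f)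
    (γ : SL(2, ℤ)) : serreIter k n (f ∣[k] γ) = serreIter k n f ∣[k + 2 * n] γ := by
  induction n with
  | zero => simp [serreIter]
  | succ n ih =>
    rw [serreIter, serreIter, ih, serre_eq_serreDerivative, serre_eq_serreDerivative,
      ← Derivative.serreDerivative_slash_equivariant (mdifferentiable_serreIter k n hf)]
    congr 1
    push_cast
    ring

lemma apply_smul_of_mem_Mset {k : ℤ} {b : ℍ → ℂ} (hb : b ∈ Mset k) (γ : SL(2, ℤ)) (z : ℍ) :
    b (γ • z) = denom γ z ^ k * b z := by
  obtain ⟨F, rfl⟩ := hb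
  exact SlashInvariantForm.slash_action_eqn_SL'' F (Subgroup.mem_top γ) z

/-- The operator `∑ B_j ∂_k^{n-j}` with modular coefficients `B_j` of weight `m + 2j` intertwines
the slash actions of weights `k` and `m + k + 2n`. -/
lemma sum_mul_serreIter_slash {k m : ℤ} {n : ℕ} {B : ℕ → ℍ → ℂ}
    (hB : ∀ j ≤ n, B j ∈ Mset (m + 2 * j)) {f : ℍ → ℂ}
    (hf : MDifferentiable 𝓘(ℂ) 𝓘(ℂ) f) (γ : SL(2, ℤ)) (z : ℍ) :
    ∑ j ∈ range (n + 1), B j z * serreIter k (n - j) (f ∣[k] γ) z =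
      (∑ j ∈ range (n + 1), B j (γ • z) * serreIter k (n - j) f (γ • z)) *
        denom γ z ^ (-(m + k + 2 * n)) := by
  rw [sum_mul]
  refine sum_congr rfl fun j hj ↦ ?_
  have hjn : j ≤ n := Nat.lt_succ_iff.mp (mem_range.mp hj)
  have hd : denom γ z ≠ 0 := denom_ne_zero _ z
  have hexp : -(k + 2 * ((n - j : ℕ) : ℤ)) = (m + 2 * j) + -(m + k + 2 * n) := by
    push_cast [hjn]
    ring
  rw [serreIter_slash k _ hf, ModularForm.SL_slash_apply, apply_smul_of_mem_Mset (hB j hjn) γ z, hexp,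
    zpow_add₀ hd]
  ring

lemma Tact_eq_smul (z : ℍ) : Tact z = ModularGroup.T • z := by
  rw [modular_T_smul]
  ext
  simp [Tact, add_comm]

lemma Sact_eq_smul (z : ℍ) : Sact z = ModularGroup.S • z := by
  rw [modular_S_smul]
  ext
  simp [Sact, inv_neg]

/-- Lemma 3 of the paper: invariance of the solution space of a
modular differential equation under the modular group. -/
theorem mde_solution_invariance (w m : ℤ) (r : ℕ) (B : ℕ → ℍ → ℂ)
    (hB : ∀ j ≤ r + 1, B j ∈ Mset (m + 2 * j))
    (K : (ℍ → ℂ) → (ℍ → ℂ))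
    (hK : ∀ (g : ℍ → ℂ) (z : ℍ),
      K g z = ∑ j ∈ Finset.range (r + 2), B j z * serreIter (w - r) (r + 1 - j) g z)
    (f : ℍ → ℂ) (hf : MDifferentiable 𝓘(ℂ) 𝓘(ℂ) f) (hsol : K f = 0) :
    K (fun z : ℍ => f (Tact z)) = 0 ∧
    K (fun z : ℍ => (z : ℂ) ^ ((r : ℤ) - w) * f (Sact z)) = 0 ∧
    ∀ γ : SL(2, ℤ),
      K (fun z : ℍ =>
        (((γ : Matrix (Fin 2) (Fin 2) ℤ) 1 0 : ℂ) * (z : ℂ)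
            + ((γ : Matrix (Fin 2) (Fin 2) ℤ) 1 1 : ℂ)) ^ ((r : ℤ) - w)
          * f (γ • z)) = 0 := by
  have hγ (γ : SL(2, ℤ)) : K (f ∣[w - r] γ) = 0 := by
    ext z
    have h0 := congrFun hsol (γ • z)
    rw [hK] at h0
    rw [hK, sum_mul_serreIter_slash hB hf, h0, Pi.zero_apply, zero_mul, Pi.zero_apply]
  have hslash (γ : SL(2, ℤ)) : f ∣[w - r] γ = fun z : ℍ =>
      (((γ : Matrix (Fin 2) (Fin 2) ℤ) 1 0 : ℂ) * (z : ℂ)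
        + ((γ : Matrix (Fin 2) (Fin 2) ℤ) 1 1 : ℂ)) ^ ((r : ℤ) - w) * f (γ • z) := by
    ext z
    rw [ModularForm.SL_slash_apply, ModularGroup.denom_apply, neg_sub, mul_comm]
  refine ⟨?_, ?_, fun γ ↦ hslash γ ▸ hγ γ⟩
  · convert hγ ModularGroup.T using 2
    ext z
    rw [hslash, Tact_eq_smul]
    simp [ModularGroup.T]
  · convert hγ ModularGroup.S using 2
    ext z
    rw [hslash, Sact_eq_smul]
    simp [ModularGroup.S]
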